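/- arXiv:2401.08557 — 3 statements merged into one kernel-verified Lean document; each statement's English description precedes it below -/
import Mathlib

section
/- For all a, b, λ > 0 there exists a constant C > 0 (depending only on a, b, λ) such that for every y > 0, ∫_0^∞ exp(−λs − y²/s) · (1+s)^a · s^{−b} ds ≤ C · (1 + y^{−2b}). -/
open MeasureTheory

lemma rpow_le_exp_aux (p c : ℝ) (hp : 0 < p) (hc : 0 < c) :
    ∃ K > (0 : ℝ), ∀ t > (0 : ℝ), t ^ p ≤ K * Real.exp (c * t) := by
  refine ⟨(p / c) ^ p, by positivity, fun t ht => ?_⟩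
  have h1 : c * t / p ≤ Real.exp (c * t / p) := by
    linarith [Real.add_one_le_exp (c * t / p)]
  have h2 := Real.rpow_le_rpow (by positivity) h1 hp.le
  rw [← Real.exp_mul, div_mul_cancel₀ _ hp.ne'] at h2
  calc t ^ p = (p / c) ^ p * (c * t / p) ^ p := by
        rw [← Real.mul_rpow (by positivity) (by positivity)]
        congr 1
        field_simp
    _ ≤ _ := by gcongr

theorem integral_exp_bound (a b lam : ℝ) (ha : 0 < a) (hb : 0 < b) (hlam : 0 < lam) :
    ∃ C > 0, ∀ y > (0 : ℝ),
      (∫ s in Set.Ioi (0 : ℝ),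
          Real.exp (-lam * s - y ^ 2 / s) * (1 + s) ^ a * s ^ (-b))
        ≤ C * (1 + y ^ (-2 * b)) := by
  obtain ⟨K1, hK1, h1⟩ := rpow_le_exp_aux b 1 hb one_pos
  obtain ⟨K2, hK2, h2⟩ := rpow_le_exp_aux a (lam / 2) ha (by positivity)
  set I := ∫ s in Set.Ioi (0 : ℝ), Real.exp (-(lam / 2) * s) with hI
  have hI0 : 0 ≤ I := integral_nonneg fun s => (Real.exp_pos _).le
  refine ⟨K1 * K2 * Real.exp (lam / 2) * I + 1, by positivity, fun y hy => ?_⟩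
  have hint : IntegrableOn (fun s : ℝ => Real.exp (-(lam / 2) * s)) (Set.Ioi 0) :=
    exp_neg_integrableOn_Ioi 0 (by positivity)
  have hy0 : 0 < y ^ (-2 * b) := by positivity
  calc _ ≤ ∫ s in Set.Ioi (0 : ℝ), (K1 * K2 * Real.exp (lam / 2) * y ^ (-2 * b)) *
            Real.exp (-(lam / 2) * s) := by
        refine integral_mono_of_nonneg ?_ (hint.const_mul _) ?_
        · filter_upwards [ae_restrict_mem measurableSet_Ioi] with s hs
          have hs : 0 < s := hs
          simp only [Pi.zero_apply]
          positivity
        · filter_upwards [ae_restrict_mem measurableSet_Ioi] with s hs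
          have hs : 0 < s := hs
          have e1 := h1 (y ^ 2 / s) (by positivity)
          have e2 := h2 (1 + s) (by positivity)
          have e3 : s ^ (-b) = (y ^ 2 / s) ^ b * y ^ (-2 * b) := by
            rw [Real.div_rpow (by positivity) hs.le, ← Real.rpow_natCast y 2,
              ← Real.rpow_mul hy.le, Real.rpow_neg hs.le, div_mul_eq_mul_div,
              ← Real.rpow_add hy]
            simp
          have e4 : s ^ (-b) ≤ K1 * Real.exp (1 * (y ^ 2 / s)) * y ^ (-2 * b) := by
            rw [e3]; gcongr
          calc _ ≤ Real.exp (-lam * s - y ^ 2 / s) * (K2 * Real.exp (lam / 2 * (1 + s))) *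
                (K1 * Real.exp (1 * (y ^ 2 / s)) * y ^ (-2 * b)) := by gcongr
            _ = K1 * K2 * y ^ (-2 * b) * (Real.exp (-lam * s - y ^ 2 / s) *
                Real.exp (lam / 2 * (1 + s)) * Real.exp (1 * (y ^ 2 / s))) := by ring
            _ = K1 * K2 * y ^ (-2 * b) * (Real.exp (lam / 2) * Real.exp (-(lam / 2) * s)) := by
                simp only [← Real.exp_add]
                congr 2
                ring
            _ = _ := by ring
    _ = (K1 * K2 * Real.exp (lam / 2) * I) * y ^ (-2 * b) := by
        rw [integral_const_mul]; ring
    _ ≤ _ := by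
        have : 0 ≤ K1 * K2 * Real.exp (lam / 2) * I := by positivity
        nlinarith
end

section
/- Let Ω₁, Ω₂, Ω₃ be measurable spaces, let G be a σ-finite measure on Ω₁ × Ω₂ and F a σ-finite measure on Ω₂ × Ω₃, let f : Ω₂ × Ω₃ → (0,∞) and g : Ω₁ × Ω₂ → (0,∞) be strictly positive measurable functions, and let μ be a σ-finite measure on Ω₁ and ν a σ-finite measure on Ω₃, each admitting a measurable set of positive finite measure. Define G' as the measure G weighted by the density (s,x) ↦ 1/g(s,x) and F' as the measure F weighted by the density (x,ζ) ↦ 1/f(x,ζ). Suppose that, as measures on Ω₁ × Ω₂ × Ω₃ (after the obvious reassociation of coordinates), the product measure G' ⊗ ν equals the product measure μ ⊗ F'. Then there exists a measure H on Ω₂ such that G' = μ ⊗ H as measures on Ω₁ × Ω₂ and F' = H ⊗ ν as measures on Ω₂ × Ω₃. -/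
open MeasureTheory

theorem disintegration_factorization
    {Ω₁ Ω₂ Ω₃ : Type*} [MeasurableSpace Ω₁] [MeasurableSpace Ω₂] [MeasurableSpace Ω₃]
    (G : Measure (Ω₁ × Ω₂)) (F : Measure (Ω₂ × Ω₃)) [SigmaFinite G] [SigmaFinite F]
    (f : Ω₂ × Ω₃ → ENNReal) (g : Ω₁ × Ω₂ → ENNReal)
    (hf : Measurable f) (hg : Measurable g)
    (hfpos : ∀ p, 0 < f p ∧ f p < ⊤) (hgpos : ∀ p, 0 < g p ∧ g p < ⊤)
    (μ : Measure Ω₁) (ν : Measure Ω₃) [SigmaFinite μ] [SigmaFinite ν]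
    (hμ : ∃ A, MeasurableSet A ∧ 0 < μ A ∧ μ A < ⊤)
    (hν : ∃ B, MeasurableSet B ∧ 0 < ν B ∧ ν B < ⊤)
    (heq : ((G.withDensity fun p => (g p)⁻¹).prod ν).map MeasurableEquiv.prodAssoc
            = μ.prod (F.withDensity fun p => (f p)⁻¹)) :
    ∃ H : Measure Ω₂,
      G.withDensity (fun p => (g p)⁻¹) = μ.prod H ∧
      F.withDensity (fun p => (f p)⁻¹) = H.prod ν := by
  generalize hG : G.withDensity (fun p => (g p)⁻¹) = G' at heq ⊢
  generalize hF : F.withDensity (fun p => (f p)⁻¹) = F' at heq ⊢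
  have : SFinite G' := by rw [← hG]; infer_instance
  have : SFinite F' := by rw [← hF]; infer_instance
  obtain ⟨A, hA, hA0, hAt⟩ := hμ
  obtain ⟨B, hB, hB0, hBt⟩ := hν
  let H₀ : Measure Ω₂ := (F'.restrict (Set.univ ×ˢ B)).map Prod.fst
  let H : Measure Ω₂ := (ν B)⁻¹ • H₀
  have hH₀ : ∀ E, MeasurableSet E → H₀ E = F' (E ×ˢ B) := by
    intro E hE
    rw [Measure.map_apply measurable_fst hE, Measure.restrict_apply (measurable_fst hE)]
    congr 1
    ext p
    simp
  have h1 : G' = μ.prod H := by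
    ext S hS
    have hSB : MeasurableSet (MeasurableEquiv.prodAssoc.symm ⁻¹' (S ×ˢ B) :
        Set (Ω₁ × Ω₂ × Ω₃)) :=
      MeasurableEquiv.prodAssoc.symm.measurable (hS.prod hB)
    have h := congrArg (fun m => m (MeasurableEquiv.prodAssoc.symm ⁻¹' (S ×ˢ B))) heq
    rw [MeasurableEquiv.map_apply, ← Set.preimage_comp, MeasurableEquiv.symm_comp_self,
      Set.preimage_id, Measure.prod_prod, Measure.prod_apply hSB] at h
    have h2 : ∀ s, F' (Prod.mk s ⁻¹' (MeasurableEquiv.prodAssoc.symm ⁻¹' (S ×ˢ B)))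
        = H₀ (Prod.mk s ⁻¹' S) := by
      intro s
      rw [hH₀ _ (measurable_prodMk_left hS)]
      rfl
    simp only [h2] at h
    rw [← Measure.prod_apply hS] at h
    rw [Measure.prod_smul_right, Measure.smul_apply, ← h, smul_eq_mul, mul_comm, mul_assoc,
      ENNReal.mul_inv_cancel hB0.ne' hBt.ne, mul_one]
  refine ⟨H, h1, ?_⟩
  rw [h1, Measure.prodAssoc_prod] at heq
  ext T hT
  have h := congrArg (fun m => m (A ×ˢ T)) heq
  simp only [Measure.prod_prod] at h
  exact ((ENNReal.mul_right_inj hA0.ne' hAt.ne).1 h).symm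
end

section
/- Let N ⊂ (0,∞) be a Lebesgue-null set, let S = (0,∞) \ N, and let c : S → (0,∞) satisfy c(s + t) = c(s)·c(t) whenever s, t, and s + t all lie in S. Then there exist s₁ > 0 and α ∈ ℝ such that q·s₁ ∈ S for every positive rational q, and c(q·s₁) = exp(α·q·s₁) for every positive rational q. -/
open MeasureTheory

theorem multiplicative_ae_exponential (N : Set ℝ) (hN : N ⊆ Set.Ioi 0)
    (hNnull : volume N = 0)
    (c : ℝ → ℝ) (hcpos : ∀ s ∈ Set.Ioi (0 : ℝ) \ N, 0 < c s)
    (hmul : ∀ s t : ℝ, s ∈ Set.Ioi (0 : ℝ) \ N → t ∈ Set.Ioi (0 : ℝ) \ N →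
      s + t ∈ Set.Ioi (0 : ℝ) \ N → c (s + t) = c s * c t) :
    ∃ s₁ > (0 : ℝ), ∃ α : ℝ,
      (∀ q : ℚ, 0 < q → (q : ℝ) * s₁ ∈ Set.Ioi (0 : ℝ) \ N) ∧
      (∀ q : ℚ, 0 < q → c ((q : ℝ) * s₁) = Real.exp (α * q * s₁)) := by
  have hnull : volume (⋃ q : {q : ℚ // 0 < q}, (fun x : ℝ => ((q : ℚ) : ℝ) * x) ⁻¹' N) = 0 := by
    rw [measure_iUnion_null_iff]
    rintro ⟨q, hq⟩
    have hq' : (q : ℝ) ≠ 0 := by exact_mod_cast hq.ne'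
    rw [Real.volume_preimage_mul_left hq', hNnull, mul_zero]
  obtain ⟨s, hs, hsN⟩ : ∃ s ∈ Set.Ioi (0 : ℝ),
      s ∉ ⋃ q : {q : ℚ // 0 < q}, (fun x : ℝ => ((q : ℚ) : ℝ) * x) ⁻¹' N := by
    by_contra! h
    have h1 := measure_mono_null (fun x hx => h x hx) hnull
    simp at h1
  have hs0 : 0 < s := hs
  have hS : ∀ q : ℚ, 0 < q → (q : ℝ) * s ∈ Set.Ioi (0 : ℝ) \ N := by
    intro q hq
    have hq' : (0 : ℝ) < q := by exact_mod_cast hq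
    refine ⟨mul_pos hq' hs0, fun h => hsN (Set.mem_iUnion.2 ⟨⟨q, hq⟩, h⟩)⟩
  have hadd : ∀ n : ℕ, ∀ q : ℚ, 0 < q →
      Real.log (c ((((n + 1 : ℕ) : ℚ) * q : ℚ) * s))
        = ((n + 1 : ℕ) : ℝ) * Real.log (c (q * s)) := by
    intro n q hq
    induction n with
    | zero => simp
    | succ n ih =>
      have hp : (0 : ℚ) < ((n + 1 : ℕ) : ℚ) * q := by positivity
      have e : (((((n + 1 + 1 : ℕ) : ℚ) * q : ℚ) : ℝ) * s)
          = ((((n + 1 : ℕ) : ℚ) * q : ℚ) : ℝ) * s + (q : ℝ) * s := by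
        push_cast; ring
      have hS2 := hS (((n + 1 + 1 : ℕ) : ℚ) * q) (by positivity)
      rw [e] at hS2 ⊢
      rw [hmul _ _ (hS _ hp) (hS _ hq) hS2,
        Real.log_mul (hcpos _ (hS _ hp)).ne' (hcpos _ (hS _ hq)).ne', ih]
      push_cast; ring
  have hadd' : ∀ n : ℕ, 0 < n → ∀ q : ℚ, 0 < q →
      Real.log (c ((((n : ℕ) : ℚ) * q : ℚ) * s)) = (n : ℝ) * Real.log (c (q * s)) := by
    intro n hn q hq
    obtain ⟨m, rfl⟩ : ∃ m, n = m + 1 := ⟨n - 1, by omega⟩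
    exact hadd m q hq
  refine ⟨s, hs0, Real.log (c s) / s, hS, fun q hq => ?_⟩
  have hnum : 0 < q.num := Rat.num_pos.2 hq
  obtain ⟨a, ha⟩ : ∃ a : ℕ, q.num = a := ⟨q.num.toNat, by omega⟩
  have h1 := hadd' q.den q.den_pos q hq
  have h2 := hadd' a (by omega) 1 one_pos
  have hqa : (q.den : ℚ) * q = (a : ℚ) * 1 := by
    rw [Rat.den_mul_eq_num, ha]; simp
  rw [hqa, h2] at h1
  have hqa' : (q.den : ℝ) * q = a := by
    have := congrArg (fun x : ℚ => (x : ℝ)) hqa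
    push_cast at this
    simpa using this
  have hd : (q.den : ℝ) ≠ 0 := by exact_mod_cast q.den_pos.ne'
  rw [← Real.exp_log (hcpos _ (hS q hq))]
  congr 1
  apply mul_left_cancel₀ hd
  rw [← h1, ← hqa']
  simp only [Rat.cast_one, one_mul]
  field_simp
end
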